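/- Let p ≥ 1, σ ∈ (0, 1/2], and let θ, θ′ ∈ [0,1]^p be such that for every index i ∈ {1,…,p} with θ′_i ≠ θ_i one has |(θ_i + θ′_i)/2 − 1/2| ≥ σ and |θ′_i − 1/2| ≤ |θ_i − 1/2|. Then φ(θ′) − φ(θ) ≥ 2σ·‖θ′ − θ‖, where ‖·‖ is the Euclidean norm and φ(θ) = Σ_{i=1}^p θ_i(1−θ_i). -/

import Mathlib

open scoped BigOperators

/-- The concave penalty function `φ(θ) = ∑ i, θ i (1 - θ i)`. -/
noncomputable def phi {p : ℕ} (θ : EuclideanSpace ℝ (Fin p)) : ℝ :=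
  ∑ i, θ i * (1 - θ i)

/-- The Euclidean norm is bounded by the `ℓ¹` norm. -/
lemma EuclideanSpace.norm_le_sum_abs {ι : Type*} [Fintype ι] (x : EuclideanSpace ℝ ι) :
    ‖x‖ ≤ ∑ i, |x i| := by
  rw [EuclideanSpace.norm_eq]
  refine Real.sqrt_le_iff.2 ⟨Finset.sum_nonneg fun i _ => abs_nonneg _, ?_⟩
  exact Finset.sum_sq_le_sq_sum_of_nonneg fun i _ => abs_nonneg _

/-- If `b` is closer to `1 / 2` than `a`, then `t ↦ t * (1 - t)` grows from `a` to `b` at the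
rate given by twice the distance from the midpoint to `1 / 2`. -/
lemma mul_one_sub_sub_mul_one_sub {a b : ℝ} (h : |b - 1 / 2| ≤ |a - 1 / 2|) :
    b * (1 - b) - a * (1 - a) = 2 * |(a + b) / 2 - 1 / 2| * |b - a| := by
  have hsq := sq_le_sq.2 h
  have heq : b * (1 - b) - a * (1 - a) = 2 * (-(((a + b) / 2 - 1 / 2) * (b - a))) := by ring
  rw [heq, mul_assoc, ← abs_mul, abs_of_nonpos (by linarith)]

/-- Lemma 2: if for every coordinate `i` with `θ'_i ≠ θ_i` the midpoint
`(θ_i + θ'_i)/2` is at distance at least `σ` from `1/2` and `θ'_i` is closer to `1/2`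
than `θ_i`, then `φ(θ') - φ(θ) ≥ 2σ ‖θ' - θ‖`. -/
theorem phi_monotone_lower_bound {p : ℕ} (hp : 1 ≤ p)
    (σ : ℝ) (hσ : σ ∈ Set.Ioc (0 : ℝ) (1 / 2))
    (θ θ' : EuclideanSpace ℝ (Fin p))
    (hθ : ∀ i, θ i ∈ Set.Icc (0 : ℝ) 1) (hθ' : ∀ i, θ' i ∈ Set.Icc (0 : ℝ) 1)
    (h : ∀ i, θ' i ≠ θ i →
      σ ≤ |(θ i + θ' i) / 2 - 1 / 2| ∧ |θ' i - 1 / 2| ≤ |θ i - 1 / 2|) :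
    2 * σ * ‖θ' - θ‖ ≤ phi θ' - phi θ := by
  have hcoord (i : Fin p) :
      2 * σ * |θ' i - θ i| ≤ θ' i * (1 - θ' i) - θ i * (1 - θ i) := by
    by_cases hi : θ' i = θ i
    · simp [hi]
    · obtain ⟨hmid, hclose⟩ := h i hi
      rw [mul_one_sub_sub_mul_one_sub hclose]
      gcongr
  calc
    2 * σ * ‖θ' - θ‖ ≤ 2 * σ * ∑ i, |θ' i - θ i| :=
      mul_le_mul_of_nonneg_left (EuclideanSpace.norm_le_sum_abs _) (by linarith [hσ.1])
    _ = ∑ i, 2 * σ * |θ' i - θ i| := Finset.mul_sum _ _ _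
    _ ≤ ∑ i, (θ' i * (1 - θ' i) - θ i * (1 - θ i)) := Finset.sum_le_sum fun i _ => hcoord i
    _ = phi θ' - phi θ := Finset.sum_sub_distrib _ _
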